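/- For every f ∈ C_c^∞(ℝⁿ×ℝⁿ) and every smooth compactly supported function K on ℝ^{n−1}×ℝ^{n−1}×ℝ₊×ℝ₊, liminf_{ℏ→0⁺} ‖ρ_ℏ(f) + κ_ℏ(K)‖ ≥ ‖π₀^∂(f⊕K)‖, where the first norm is the operator norm on L²(ℝⁿ₊). -/

import Mathlib

open MeasureTheory Filter Topology Set
open scoped ContDiff

noncomputable section

/-- `ℝ^{n−1}`, the boundary directions. -/
abbrev Eb (n : ℕ) : Type := Fin (n - 1) → ℝ

/-- `ℝⁿ` written as `ℝ^{n−1} × ℝ`; a point is `x = (x', xₙ)`. -/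
abbrev Ef (n : ℕ) : Type := Eb n × ℝ

/-- Lebesgue measure restricted to the closed half-space `ℝⁿ₊ = {x : xₙ ≥ 0}`. -/
def muPlus (n : ℕ) : Measure (Ef n) := volume.restrict {p : Ef n | 0 ≤ p.2}

/-- `L²(ℝⁿ₊)`. -/
abbrev HS (n : ℕ) := Lp ℂ 2 (muPlus n)

/-- `T` is the ℏ-scaled truncated operator `ρ_ℏ(f)` on `L²(ℝⁿ₊)`:
`(ρ_ℏ(f)ξ)(x) = ∫_{v : xₙ ≥ ℏvₙ} f(x,v) ξ(x−ℏv) dv`. -/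
def rhoSpec (n : ℕ) (ℏ : ℝ) (f : Ef n × Ef n → ℂ) (T : HS n →L[ℂ] HS n) : Prop :=
  ∀ ξ : HS n, ⇑(T ξ) =ᵐ[muPlus n]
    fun x => ∫ v in {v : Ef n | ℏ * v.2 ≤ x.2},
      f (x, v) * (ξ (x.1 - ℏ • v.1, x.2 - ℏ * v.2))

/-- `S` is the ℏ-scaled Green-type operator `κ_ℏ(K)` on `L²(ℝⁿ₊)`:
`(κ_ℏ(K)ξ)(x',xₙ) = ∫_{ℝ^{n−1}} ∫₀^∞ K(x',y',xₙ/ℏ,yₙ) ξ(x'−ℏy', ℏyₙ) dyₙ dy'`. -/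
def kappaSpec (n : ℕ) (ℏ : ℝ) (K : Eb n × Eb n × ℝ × ℝ → ℂ) (S : HS n →L[ℂ] HS n) : Prop :=
  ∀ ξ : HS n, ⇑(S ξ) =ᵐ[muPlus n]
    fun x => ∫ y' : Eb n, ∫ yn in Ioi (0:ℝ),
      K (x.1, y', x.2 / ℏ, yn) * (ξ (x.1 - ℏ • y', ℏ * yn))

/-- The measure on `ℝⁿ₊ × ℝⁿ` (base point in the half-space, tangent vector free). -/
def muT (n : ℕ) : Measure (Ef n × Ef n) := (muPlus n).prod volume

/-- `L²(ℝⁿ₊ × ℝⁿ)`. -/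
abbrev HT (n : ℕ) := Lp ℂ 2 (muT n)

/-- `P` is the fiberwise convolution operator `π₀(f)` on `L²(ℝⁿ₊×ℝⁿ)`:
`(π₀(f)ξ)(x,v) = ∫ f(x,w) ξ(x,v−w) dw`. -/
def pi0Spec (n : ℕ) (f : Ef n × Ef n → ℂ) (P : HT n →L[ℂ] HT n) : Prop :=
  ∀ ξ : HT n, ⇑(P ξ) =ᵐ[muT n] fun p => ∫ w : Ef n, f (p.1, w) * (ξ (p.1, p.2 - w))

/-- Lebesgue measure on `ℝ^{n−1} × ℝ^{n−1} × ℝ` restricted to `ℝ^{n−1} × ℝ^{n−1} × ℝ₊`. -/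
def muB (n : ℕ) : Measure (Eb n × Eb n × ℝ) :=
  volume.restrict {q : Eb n × Eb n × ℝ | 0 ≤ q.2.2}

/-- `L²(ℝ^{n−1} × ℝ^{n−1} × ℝ₊)`. -/
abbrev HB (n : ℕ) := Lp ℂ 2 (muB n)

/-- `B` is the boundary operator `π₀^∂(f⊕K)` on `L²(ℝ^{n−1}×ℝ^{n−1}×ℝ₊)`:
`(π₀^∂(f⊕K)ξ)(x',v',vₙ) = ∫_{ℝ^{n−1}} ∫₀^∞ [f(x',0,v'−w',vₙ−wₙ) + K(x',v'−w',vₙ,wₙ)]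
ξ(x',w',wₙ) dwₙ dw'`. -/
def piBSpec (n : ℕ) (f : Ef n × Ef n → ℂ) (K : Eb n × Eb n × ℝ × ℝ → ℂ)
    (B : HB n →L[ℂ] HB n) : Prop :=
  ∀ ξ : HB n, ⇑(B ξ) =ᵐ[muB n]
    fun q => ∫ w' : Eb n, ∫ wn in Ioi (0:ℝ),
      (f ((q.1, (0:ℝ)), (q.2.1 - w', q.2.2 - wn)) + K (q.1, q.2.1 - w', q.2.2, wn)) *
        (ξ (q.1, w', wn))

/-- Fiberwise convolution `(f*g)(x,w) = ∫ f(x,v) g(x,w−v) dv`. -/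
def fconv (n : ℕ) (f g : Ef n × Ef n → ℂ) : Ef n × Ef n → ℂ :=
  fun p => ∫ v : Ef n, f (p.1, v) * g (p.1, p.2 - v)

/-- The Green symbol `l(f,g)(x',y',xₙ,yₙ) =
−∫_{ℝ^{n−1}} ∫_{xₙ}^∞ f(x',0,y'−v',vₙ) g(x',0,v',xₙ−vₙ−yₙ) dvₙ dv'`. -/
def lGreen (n : ℕ) (f g : Ef n × Ef n → ℂ) : Eb n × Eb n × ℝ × ℝ → ℂ :=
  fun q => -(∫ v' : Eb n, ∫ vn in Ici q.2.2.1,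
    f ((q.1, (0:ℝ)), (q.2.1 - v', vn)) * g ((q.1, (0:ℝ)), (v', q.2.2.1 - vn - q.2.2.2)))

instance instHaarEf (n : ℕ) : (volume : Measure (Ef n)).IsAddHaarMeasure :=
  inferInstanceAs ((volume : Measure (Eb n)).prod (volume : Measure ℝ)).IsAddHaarMeasure

lemma measurableSet_half (n : ℕ) : MeasurableSet {p : Ef n | 0 ≤ p.2} :=
  measurableSet_le measurable_const measurable_snd

instance instSFinitePlus (n : ℕ) : SFinite (muPlus n) := by
  unfold muPlus; infer_instance

lemma muPlus_eq_prod (n : ℕ) :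
    muPlus n = (volume : Measure (Eb n)).prod ((volume : Measure ℝ).restrict (Ioi 0)) := by
  have h : ((volume : Measure ℝ).restrict (Ioi 0)) = volume.restrict (Ici 0) :=
    Measure.restrict_congr_set Ioi_ae_eq_Ici
  rw [h]
  conv_rhs => rw [← Measure.restrict_univ (μ := (volume : Measure (Eb n)))]
  rw [Measure.prod_restrict]
  unfold muPlus
  congr 1
  ext p; simp

lemma muB_eq_prod (n : ℕ) : muB n = (volume : Measure (Eb n)).prod (muPlus n) := by
  conv_rhs => rw [← Measure.restrict_univ (μ := (volume : Measure (Eb n)))]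
  unfold muPlus
  rw [Measure.prod_restrict]
  unfold muB
  congr 1
  ext p; simp

lemma integral_muPlus {n : ℕ} (g : Ef n → ℂ) (hg : Integrable g (muPlus n)) :
    ∫ w, g w ∂(muPlus n) = ∫ w' : Eb n, ∫ wn in Ioi (0:ℝ), g (w', wn) := by
  rw [muPlus_eq_prod] at hg ⊢
  exact integral_prod g hg

/-- The scaling map. -/
def psi (n : ℕ) (ℏ : ℝ) (x0 : Eb n) (v : Ef n) : Ef n := (x0 + ℏ • v.1, ℏ * v.2)

/-- The inverse of the scaling map. -/
def psiInv (n : ℕ) (ℏ : ℝ) (x0 : Eb n) (v : Ef n) : Ef n := (ℏ⁻¹ • (v.1 - x0), ℏ⁻¹ * v.2)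

lemma psiInv_psi {n : ℕ} {ℏ : ℝ} (h : 0 < ℏ) (x0 : Eb n) (v : Ef n) :
    psiInv n ℏ x0 (psi n ℏ x0 v) = v := by
  ext <;> simp [psi, psiInv, h.ne']

lemma psi_psiInv {n : ℕ} {ℏ : ℝ} (h : 0 < ℏ) (x0 : Eb n) (v : Ef n) :
    psi n ℏ x0 (psiInv n ℏ x0 v) = v := by
  ext <;> simp [psi, psiInv, h.ne']

lemma psi_emb {n : ℕ} {ℏ : ℝ} (h : 0 < ℏ) (x0 : Eb n) :
    MeasurableEmbedding (psi n ℏ x0) := by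
  let e : Ef n ≃ᵐ Ef n :=
    { toFun := psi n ℏ x0
      invFun := psiInv n ℏ x0
      left_inv := psiInv_psi h x0
      right_inv := psi_psiInv h x0
      measurable_toFun := by
        have : Continuous (psi n ℏ x0) := by unfold psi; fun_prop
        exact this.measurable
      measurable_invFun := by
        have : Continuous (psiInv n ℏ x0) := by unfold psiInv; fun_prop
        exact this.measurable }
  exact e.measurableEmbedding

lemma map_psi {n : ℕ} {ℏ : ℝ} (h : 0 < ℏ) (x0 : Eb n) :
    ∃ c : ENNReal, c ≠ 0 ∧ c ≠ ⊤ ∧ Measure.map (psi n ℏ x0) (muPlus n) = c • muPlus n := by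
  refine ⟨ENNReal.ofReal |(ℏ ^ Module.finrank ℝ (Ef n))⁻¹|, ?_, ENNReal.ofReal_ne_top, ?_⟩
  · have : 0 < |(ℏ ^ Module.finrank ℝ (Ef n))⁻¹| := by positivity
    exact (ENNReal.ofReal_pos.2 this).ne'
  · have h1 : Measure.map (psi n ℏ x0) (volume : Measure (Ef n)) =
        ENNReal.ofReal |(ℏ ^ Module.finrank ℝ (Ef n))⁻¹| • volume := by
      have : psi n ℏ x0 = (fun y : Ef n => ((x0, 0) : Ef n) + y) ∘ (fun x : Ef n => ℏ • x) := by
        funext v; ext <;> simp [psi]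
      rw [this, ← Measure.map_map (by fun_prop) (by fun_prop),
        Measure.map_addHaar_smul _ h.ne', Measure.map_smul, map_add_left_eq_self]
    have h2 : psi n ℏ x0 ⁻¹' {p : Ef n | 0 ≤ p.2} = {p : Ef n | 0 ≤ p.2} := by
      ext v; simp [psi, h]
    unfold muPlus
    conv_lhs => rw [← h2]
    rw [← (psi_emb h x0).restrict_map, h1, Measure.restrict_smul]

lemma eLpNorm_psi {n : ℕ} {ℏ : ℝ} (h : 0 < ℏ) (x0 : Eb n) :
    ∃ c : ENNReal, c ≠ 0 ∧ c ≠ ⊤ ∧ ∀ g : Ef n → ℂ,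
      eLpNorm (g ∘ psi n ℏ x0) 2 (muPlus n) = c * eLpNorm g 2 (muPlus n) := by
  obtain ⟨c, hc0, hct, hc⟩ := map_psi h x0
  refine ⟨c ^ (1 / (2 : ENNReal)).toReal, ?_, ?_, fun g => ?_⟩
  · exact (ENNReal.rpow_pos (pos_iff_ne_zero.2 hc0) hct).ne'
  · exact ENNReal.rpow_ne_top_of_nonneg (by positivity) hct
  · rw [← (psi_emb h x0).eLpNorm_map_measure, hc, eLpNorm_smul_measure_of_ne_top (by simp)]
    rfl

lemma memLp_psi {n : ℕ} {ℏ : ℝ} (h : 0 < ℏ) (x0 : Eb n) (g : Ef n → ℂ) :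
    MemLp (g ∘ psi n ℏ x0) 2 (muPlus n) ↔ MemLp g 2 (muPlus n) := by
  obtain ⟨c, hc0, hct, hc⟩ := map_psi h x0
  rw [← (psi_emb h x0).memLp_map_measure_iff, hc]
  constructor
  · intro hg
    have := hg.smul_measure (c := c⁻¹) (by simpa using hc0)
    rwa [smul_smul, ENNReal.inv_mul_cancel hc0 hct, one_smul] at this
  · intro hg
    exact hg.smul_measure hct

lemma ae_psi {n : ℕ} {ℏ : ℝ} (h : 0 < ℏ) (x0 : Eb n) {p : Ef n → Prop}
    (hp : ∀ᵐ x ∂(muPlus n), p x) : ∀ᵐ v ∂(muPlus n), p (psi n ℏ x0 v) := by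
  obtain ⟨c, hc0, hct, hc⟩ := map_psi h x0
  rw [← (psi_emb h x0).ae_map_iff, hc]
  exact Measure.ae_smul_measure hp c

/-- Integral operator on the half space. -/
def Gk {n : ℕ} (k : Ef n → Ef n → ℂ) (η : Ef n → ℂ) (v : Ef n) : ℂ :=
  ∫ w, k v w * η w ∂(muPlus n)

/-- The rescaled kernel, `f` part. -/
def kf {n : ℕ} (f : Ef n × Ef n → ℂ) (ℏ : ℝ) (x0 : Eb n) (v w : Ef n) : ℂ :=
  f ((x0 + ℏ • v.1, ℏ * v.2), (v.1 - w.1, v.2 - w.2))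

/-- The rescaled kernel, `K` part. -/
def kK {n : ℕ} (K : Eb n × Eb n × ℝ × ℝ → ℂ) (ℏ : ℝ) (x0 : Eb n) (v w : Ef n) : ℂ :=
  K (x0 + ℏ • v.1, v.1 - w.1, v.2, w.2)

/-- Kernel bound. -/
def KB {n : ℕ} (C R : ℝ) (k : Ef n → Ef n → ℂ) : Prop :=
  ∀ v w, ‖k v w‖ ≤ (Metric.closedBall v R).indicator (fun _ => C) w

lemma KB_add {n : ℕ} {C R C' R' : ℝ} (hC : 0 ≤ C) (hC' : 0 ≤ C') {k k' : Ef n → Ef n → ℂ}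
    (h : KB C R k) (h' : KB C' R' k') :
    KB (C + C') (max R R') (fun v w => k v w + k' v w) := by
  intro v w
  refine (norm_add_le _ _).trans ((add_le_add (h v w) (h' v w)).trans ?_)
  by_cases hw : w ∈ Metric.closedBall v (max R R')
  · rw [indicator_of_mem hw]
    exact add_le_add (indicator_le_self' (fun _ _ => hC) w) (indicator_le_self' (fun _ _ => hC') w)
  · have h1 : w ∉ Metric.closedBall v R :=
      fun hh => hw (Metric.closedBall_subset_closedBall (le_max_left _ _) hh)
    have h2 : w ∉ Metric.closedBall v R' :=
      fun hh => hw (Metric.closedBall_subset_closedBall (le_max_right _ _) hh)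
    simp [h1, h2, hw]

lemma kf_bound {n : ℕ} (f : Ef n × Ef n → ℂ) (hf : Continuous f) (hf' : HasCompactSupport f) :
    ∃ C R : ℝ, 0 ≤ C ∧ ∀ ℏ x0, KB C R (kf (n := n) f ℏ x0) := by
  obtain ⟨C, hC⟩ := hf'.exists_bound_of_continuous hf
  obtain ⟨R, hR⟩ := hf'.isCompact.isBounded.subset_closedBall 0
  refine ⟨C, R, (norm_nonneg _).trans (hC 0), fun ℏ x0 v w => ?_⟩
  by_cases hw : w ∈ Metric.closedBall v R
  · rw [indicator_of_mem hw]; exact hC _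
  · rw [indicator_of_notMem hw]
    unfold kf
    refine (norm_eq_zero.2 (image_eq_zero_of_notMem_tsupport ?_)).le
    intro hm
    apply hw
    have := hR hm
    rw [mem_closedBall_zero_iff, Prod.norm_def, max_le_iff] at this
    rw [Metric.mem_closedBall, dist_comm, dist_eq_norm]
    exact this.2

lemma kK_bound {n : ℕ} (K : Eb n × Eb n × ℝ × ℝ → ℂ) (hK : Continuous K)
    (hK' : HasCompactSupport K) :
    ∃ C R : ℝ, 0 ≤ C ∧ ∀ ℏ x0, KB C R (kK (n := n) K ℏ x0) := by
  obtain ⟨C, hC⟩ := hK'.exists_bound_of_continuous hK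
  obtain ⟨R, hR⟩ := hK'.isCompact.isBounded.subset_closedBall 0
  refine ⟨C, 2 * R, (norm_nonneg _).trans (hC 0), fun ℏ x0 v w => ?_⟩
  by_cases hw : w ∈ Metric.closedBall v (2 * R)
  · rw [indicator_of_mem hw]; exact hC _
  · rw [indicator_of_notMem hw]
    unfold kK
    refine (norm_eq_zero.2 (image_eq_zero_of_notMem_tsupport ?_)).le
    intro hm
    apply hw
    have := hR hm
    rw [mem_closedBall_zero_iff] at this
    simp only [Prod.norm_def, max_le_iff] at this
    obtain ⟨h1, h2, h3, h4⟩ := this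
    rw [Metric.mem_closedBall, dist_comm, dist_eq_norm, Prod.norm_def, max_le_iff]
    have hR0 : 0 ≤ R := (norm_nonneg _).trans h1
    refine ⟨h2.trans (by linarith), (norm_sub_le _ _).trans (by linarith)⟩

lemma bound_integrable {n : ℕ} (C R : ℝ) (η : Ef n → ℂ) (hη : MemLp η 2 (muPlus n)) (v : Ef n) :
    Integrable (fun w => (Metric.closedBall v R).indicator (fun _ => C) w * ‖η w‖) (muPlus n) := by
  have hfin : IsFiniteMeasure ((muPlus n).restrict (Metric.closedBall v R)) := by
    refine ⟨?_⟩
    rw [Measure.restrict_apply_univ]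
    exact (Measure.restrict_apply_le _ _).trans_lt measure_closedBall_lt_top
  have h1 : Integrable η ((muPlus n).restrict (Metric.closedBall v R)) :=
    (hη.restrict _).integrable (by norm_num)
  have h2 : IntegrableOn (fun w => C * ‖η w‖) (Metric.closedBall v R) (muPlus n) :=
    h1.norm.const_mul C
  have h3 := h2.integrable_indicator Metric.isClosed_closedBall.measurableSet
  refine h3.congr (Eventually.of_forall fun w => ?_)
  by_cases hw : w ∈ Metric.closedBall v R <;> simp [hw]

lemma KB_norm {n : ℕ} {C R : ℝ} {k : Ef n → Ef n → ℂ} (h : KB C R k) (η : Ef n → ℂ) (v w : Ef n) :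
    ‖k v w * η w‖ ≤ (Metric.closedBall v R).indicator (fun _ => C) w * ‖η w‖ := by
  rw [norm_mul]
  exact mul_le_mul_of_nonneg_right (h v w) (norm_nonneg _)

lemma KB_integrable {n : ℕ} {C R : ℝ} {k : Ef n → Ef n → ℂ} (h : KB C R k)
    (hk : ∀ v, Continuous (k v)) (η : Ef n → ℂ) (hη : MemLp η 2 (muPlus n)) (v : Ef n) :
    Integrable (fun w => k v w * η w) (muPlus n) :=
  (bound_integrable C R η hη v).mono' ((hk v).aestronglyMeasurable.mul hη.1)
    (Eventually.of_forall fun w => KB_norm h η v w)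

lemma kf_cont {n : ℕ} (f : Ef n × Ef n → ℂ) (hf : Continuous f) (ℏ : ℝ) (x0 : Eb n) (v : Ef n) :
    Continuous (kf f ℏ x0 v) := by unfold kf; fun_prop

lemma kK_cont {n : ℕ} (K : Eb n × Eb n × ℝ × ℝ → ℂ) (hK : Continuous K) (ℏ : ℝ) (x0 : Eb n)
    (v : Ef n) : Continuous (kK K ℏ x0 v) := by unfold kK; fun_prop

lemma eLpNorm_sq {α : Type*} [MeasurableSpace α] (μ : Measure α) (g : α → ℂ) :
    eLpNorm g 2 μ ^ 2 = ∫⁻ x, ‖g x‖ₑ ^ 2 ∂μ := by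
  have := eLpNorm_nnreal_pow_eq_lintegral (μ := μ) (f := g) (p := 2) (by norm_num)
  simpa using this

lemma schur {n : ℕ} {C R : ℝ} (k : Ef n → Ef n → ℂ) (h : KB C R k)
    (η : Ef n → ℂ) (hη : MemLp η 2 (muPlus n)) :
    eLpNorm (Gk k η) 2 (muPlus n) ≤
      ENNReal.ofReal C * volume (Metric.closedBall (0 : Ef n) R) * eLpNorm η 2 (muPlus n) := by
  set V := volume (Metric.closedBall (0 : Ef n) R) with hV
  have hVv : ∀ v : Ef n, (muPlus n) (Metric.closedBall v R) ≤ V := fun v => by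
    refine (Measure.restrict_apply_le _ _).trans ?_
    rw [hV, Measure.addHaar_closedBall_center]
  have hpt : ∀ v, ‖Gk k η v‖ₑ ^ 2 ≤ ENNReal.ofReal C ^ 2 * V *
      ∫⁻ w, (Metric.closedBall v R).indicator (fun w => ‖η w‖ₑ ^ 2) w ∂(muPlus n) := by
    intro v
    rw [lintegral_indicator Metric.isClosed_closedBall.measurableSet, ← eLpNorm_sq]
    have h1 : ‖Gk k η v‖ₑ ≤ ENNReal.ofReal C *
        ∫⁻ w in Metric.closedBall v R, ‖η w‖ₑ ∂(muPlus n) := by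
      refine (enorm_integral_le_lintegral_enorm _).trans ?_
      rw [← lintegral_const_mul' _ _ ENNReal.ofReal_ne_top,
        ← lintegral_indicator Metric.isClosed_closedBall.measurableSet]
      refine lintegral_mono fun w => ?_
      have := h v w
      rw [enorm_mul]
      by_cases hw : w ∈ Metric.closedBall v R
      · rw [indicator_of_mem hw] at this ⊢
        gcongr
        rw [← ofReal_norm]
        exact ENNReal.ofReal_le_ofReal this
      · rw [indicator_of_notMem hw] at this ⊢
        have h0 : k v w = 0 := norm_le_zero_iff.1 this
        simp [h0]
    have h2 : ∫⁻ w in Metric.closedBall v R, ‖η w‖ₑ ∂(muPlus n) ≤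
        eLpNorm η 2 ((muPlus n).restrict (Metric.closedBall v R)) * V ^ (1 / 2 : ℝ) := by
      rw [← eLpNorm_one_eq_lintegral_enorm]
      refine (eLpNorm_le_eLpNorm_mul_rpow_measure_univ (p := 1) (q := 2) (by norm_num)
        hη.1.restrict).trans ?_
      rw [Measure.restrict_apply_univ]
      norm_num
      gcongr
      exact hVv v
    calc ‖Gk k η v‖ₑ ^ 2 ≤ (ENNReal.ofReal C *
          (eLpNorm η 2 ((muPlus n).restrict (Metric.closedBall v R)) * V ^ (1 / 2 : ℝ))) ^ 2 := by
          gcongr; exact h1.trans (by gcongr)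
      _ = ENNReal.ofReal C ^ 2 * (V ^ (1 / 2 : ℝ)) ^ 2 *
          eLpNorm η 2 ((muPlus n).restrict (Metric.closedBall v R)) ^ 2 := by ring
      _ = _ := by
          congr 2
          rw [← ENNReal.rpow_natCast, ← ENNReal.rpow_mul]; norm_num
  have hsq : eLpNorm (Gk k η) 2 (muPlus n) ^ 2 ≤
      (ENNReal.ofReal C * V * eLpNorm η 2 (muPlus n)) ^ 2 := by
    rw [eLpNorm_sq]
    have hVt : V ≠ ⊤ := measure_closedBall_lt_top.ne
    calc ∫⁻ v, ‖Gk k η v‖ₑ ^ 2 ∂(muPlus n) ≤ ∫⁻ v, ENNReal.ofReal C ^ 2 * V *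
          ∫⁻ w, (Metric.closedBall v R).indicator (fun w => ‖η w‖ₑ ^ 2) w ∂(muPlus n)
            ∂(muPlus n) := lintegral_mono hpt
      _ = ENNReal.ofReal C ^ 2 * V * ∫⁻ v,
          ∫⁻ w, (Metric.closedBall v R).indicator (fun w => ‖η w‖ₑ ^ 2) w ∂(muPlus n)
            ∂(muPlus n) := lintegral_const_mul' _ _
              (ENNReal.mul_ne_top (by simp) hVt)
      _ = ENNReal.ofReal C ^ 2 * V * ∫⁻ w,
          ∫⁻ v, (Metric.closedBall v R).indicator (fun w => ‖η w‖ₑ ^ 2) w ∂(muPlus n)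
            ∂(muPlus n) := by
          congr 1
          refine lintegral_lintegral_swap ?_
          have hs : MeasurableSet {p : Ef n × Ef n | p.2 ∈ Metric.closedBall p.1 R} :=
            measurableSet_le (f := fun p : Ef n × Ef n => dist p.2 p.1) (by fun_prop)
              measurable_const
          have : (Function.uncurry fun v w =>
              (Metric.closedBall v R).indicator (fun w => ‖η w‖ₑ ^ 2) w) =
              {p : Ef n × Ef n | p.2 ∈ Metric.closedBall p.1 R}.indicator
                (fun p => ‖η p.2‖ₑ ^ 2) := by
            funext p
            by_cases hp : p.2 ∈ Metric.closedBall p.1 R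
            · rw [indicator_of_mem (by exact hp)]
              simp only [Function.uncurry]
              rw [indicator_of_mem hp]
            · rw [indicator_of_notMem (by exact hp)]
              simp only [Function.uncurry]
              rw [indicator_of_notMem hp]
          rw [this]
          refine AEMeasurable.indicator ?_ hs
          exact (hη.1.comp_snd.enorm).pow_const 2
      _ ≤ ENNReal.ofReal C ^ 2 * V * ∫⁻ w, V * ‖η w‖ₑ ^ 2 ∂(muPlus n) := by
          gcongr with w
          have : ∀ v, (Metric.closedBall v R).indicator (fun w => ‖η w‖ₑ ^ 2) w =
              (Metric.closedBall w R).indicator (fun _ => ‖η w‖ₑ ^ 2) v := by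
            intro v
            by_cases hv : w ∈ Metric.closedBall v R
            · rw [indicator_of_mem hv, indicator_of_mem (Metric.mem_closedBall_comm.1 hv)]
            · rw [indicator_of_notMem hv,
                indicator_of_notMem (fun hh => hv (Metric.mem_closedBall_comm.1 hh))]
          simp_rw [this]
          rw [lintegral_indicator_const Metric.isClosed_closedBall.measurableSet, mul_comm]
          gcongr
          exact hVv w
      _ = _ := by
          rw [lintegral_const_mul' _ _ hVt, ← eLpNorm_sq]; ring
  exact (ENNReal.pow_le_pow_left_iff (by norm_num)).1 hsq

lemma conj_formula {n : ℕ} (f : Ef n × Ef n → ℂ) (hf : Continuous f) (hf' : HasCompactSupport f)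
    (K : Eb n × Eb n × ℝ × ℝ → ℂ) (hK : Continuous K) (hK' : HasCompactSupport K)
    {ℏ : ℝ} (h : 0 < ℏ) (T S : HS n →L[ℂ] HS n)
    (hT : rhoSpec n ℏ f T) (hS : kappaSpec n ℏ K S) (x0 : Eb n) (ξ : HS n) :
    (⇑((T + S) ξ)) ∘ psi n ℏ x0 =ᵐ[muPlus n]
      Gk (fun v w => kf f ℏ x0 v w + kK K ℏ x0 v w) (⇑ξ ∘ psi n ℏ x0) := by
  obtain ⟨C, R, hC, hkf⟩ := kf_bound f hf hf'
  obtain ⟨C', R', hC', hkK⟩ := kK_bound K hK hK'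
  have hη : MemLp (⇑ξ ∘ psi n ℏ x0) 2 (muPlus n) := (memLp_psi h x0 _).2 (Lp.memLp ξ)
  have e0 : ⇑((T + S) ξ) =ᵐ[muPlus n] ⇑(T ξ) + ⇑(S ξ) := by
    rw [ContinuousLinearMap.add_apply]; exact Lp.coeFn_add _ _
  filter_upwards [ae_psi h x0 e0, ae_psi h x0 (hT ξ), ae_psi h x0 (hS ξ)] with u h0 h1 h2
  rw [Function.comp_apply, h0, Pi.add_apply, h1, h2]
  have i1 := KB_integrable (hkf ℏ x0) (kf_cont f hf ℏ x0) _ hη u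
  have i2 := KB_integrable (hkK ℏ x0) (kK_cont K hK ℏ x0) _ hη u
  unfold Gk
  simp_rw [add_mul]
  rw [integral_add i1 i2]
  congr 1
  · unfold muPlus
    rw [← integral_indicator (measurableSet_half n), ← integral_indicator
      (measurableSet_le (by fun_prop) (by fun_prop)), ← integral_sub_left_eq_self _ _ u]
    congr 1
    funext w
    have hset : (u - w) ∈ {v : Ef n | ℏ * v.2 ≤ (psi n ℏ x0 u).2} ↔ w ∈ {p : Ef n | 0 ≤ p.2} := by
      simp only [psi, mem_setOf_eq, Prod.snd_sub]
      rw [mul_le_mul_iff_right₀ h]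
      constructor <;> intro hh <;> linarith
    by_cases hw : w ∈ {p : Ef n | 0 ≤ p.2}
    · rw [indicator_of_mem (hset.2 hw), indicator_of_mem hw]
      have : ((psi n ℏ x0 u).1 - ℏ • (u - w).1, (psi n ℏ x0 u).2 - ℏ * (u - w).2)
          = psi n ℏ x0 w := by
        ext
        · simp [psi]; ring
        · simp [psi]; ring
      rw [this]
      rfl
    · rw [indicator_of_notMem (fun hh => hw (hset.1 hh)), indicator_of_notMem hw]
  · rw [integral_muPlus _ i2, ← integral_sub_left_eq_self _ _ u.1]
    congr 1
    funext w'
    congr 1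
    funext wn
    have e1 : (psi n ℏ x0 u).2 / ℏ = u.2 := by simp [psi, h.ne']
    have e2 : ((psi n ℏ x0 u).1 - ℏ • (u.1 - w'), ℏ * wn) = psi n ℏ x0 (w', wn) := by
      ext
      · simp [psi]; ring
      · simp [psi]
    rw [e1, e2]
    rfl

lemma fiber_bound_h {n : ℕ} (f : Ef n × Ef n → ℂ) (hf : Continuous f) (hf' : HasCompactSupport f)
    (K : Eb n × Eb n × ℝ × ℝ → ℂ) (hK : Continuous K) (hK' : HasCompactSupport K)
    {ℏ : ℝ} (h : 0 < ℏ) (T S : HS n →L[ℂ] HS n)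
    (hT : rhoSpec n ℏ f T) (hS : kappaSpec n ℏ K S) (x0 : Eb n) (η : Ef n → ℂ)
    (hη : MemLp η 2 (muPlus n)) :
    AEStronglyMeasurable (Gk (fun v w => kf f ℏ x0 v w + kK K ℏ x0 v w) η) (muPlus n) ∧
    eLpNorm (Gk (fun v w => kf f ℏ x0 v w + kK K ℏ x0 v w) η) 2 (muPlus n) ≤
      ENNReal.ofReal ‖T + S‖ * eLpNorm η 2 (muPlus n) := by
  have hcomp : (η ∘ psiInv n ℏ x0) ∘ psi n ℏ x0 = η := by
    funext v; simp [psiInv_psi h]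
  have hζ : MemLp (η ∘ psiInv n ℏ x0) 2 (muPlus n) := by
    rw [← memLp_psi h x0, hcomp]; exact hη
  set ξ : HS n := hζ.toLp _ with hξ
  have hae : ⇑ξ ∘ psi n ℏ x0 =ᵐ[muPlus n] η := by
    have := ae_psi h x0 hζ.coeFn_toLp
    filter_upwards [this] with v hv
    rw [Function.comp_apply, hξ, hv, Function.comp_apply, psiInv_psi h]
  have hG : Gk (fun v w => kf f ℏ x0 v w + kK K ℏ x0 v w) η =
      Gk (fun v w => kf f ℏ x0 v w + kK K ℏ x0 v w) (⇑ξ ∘ psi n ℏ x0) := by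
    funext v
    refine integral_congr_ae ?_
    filter_upwards [hae] with w hw
    rw [hw]
  have hcf := conj_formula f hf hf' K hK hK' h T S hT hS x0 ξ
  rw [hG]
  refine ⟨?_, ?_⟩
  · exact (((memLp_psi h x0 _).2 (Lp.memLp ((T + S) ξ))).1).congr hcf
  · rw [← eLpNorm_congr_ae hcf, ← eLpNorm_congr_ae hae]
    obtain ⟨c, hc0, hct, hc⟩ := eLpNorm_psi h x0
    rw [hc, hc]
    have : eLpNorm (⇑((T + S) ξ)) 2 (muPlus n) ≤
        ENNReal.ofReal ‖T + S‖ * eLpNorm (⇑ξ) 2 (muPlus n) := by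
      rw [← Lp.enorm_def, ← Lp.enorm_def, ofReal_norm]
      exact ContinuousLinearMap.le_opNorm_enorm _ _
    calc _ ≤ c * (ENNReal.ofReal ‖T + S‖ * eLpNorm (⇑ξ) 2 (muPlus n)) := by gcongr
      _ = _ := by ring

lemma unif_bound {n : ℕ} (f : Ef n × Ef n → ℂ) (hf : Continuous f) (hf' : HasCompactSupport f)
    (K : Eb n × Eb n × ℝ × ℝ → ℂ) (hK : Continuous K) (hK' : HasCompactSupport K) :
    ∃ M : ℝ, ∀ ℏ : ℝ, 0 < ℏ → ∀ T S : HS n →L[ℂ] HS n,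
      rhoSpec n ℏ f T → kappaSpec n ℏ K S → ‖T + S‖ ≤ M := by
  obtain ⟨C, R, hC, hkf⟩ := kf_bound f hf hf'
  obtain ⟨C', R', hC', hkK⟩ := kK_bound K hK hK'
  set D := ENNReal.ofReal (C + C') * volume (Metric.closedBall (0 : Ef n) (max R R')) with hD
  have hDt : D ≠ ⊤ := ENNReal.mul_ne_top (by simp) measure_closedBall_lt_top.ne
  refine ⟨D.toReal, fun ℏ h T S hT hS => ?_⟩
  refine ContinuousLinearMap.opNorm_le_bound _ ENNReal.toReal_nonneg fun ξ => ?_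
  have hη : MemLp (⇑ξ ∘ psi n ℏ 0) 2 (muPlus n) := (memLp_psi h 0 _).2 (Lp.memLp ξ)
  have h1 := schur _ (KB_add hC hC' (hkf ℏ 0) (hkK ℏ 0)) _ hη
  rw [← eLpNorm_congr_ae (conj_formula f hf hf' K hK hK' h T S hT hS 0 ξ)] at h1
  obtain ⟨c, hc0, hct, hc⟩ := eLpNorm_psi (n := n) h 0
  rw [hc, hc, ← hD, mul_left_comm, ENNReal.mul_le_mul_iff_right hc0 hct] at h1
  rw [Lp.norm_def, Lp.norm_def, ← ENNReal.toReal_mul]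
  exact ENNReal.toReal_mono (ENNReal.mul_ne_top hDt (Lp.eLpNorm_ne_top ξ)) h1

lemma fiber_bound {n : ℕ} (f : Ef n × Ef n → ℂ) (hf : Continuous f) (hf' : HasCompactSupport f)
    (K : Eb n × Eb n × ℝ × ℝ → ℂ) (hK : Continuous K) (hK' : HasCompactSupport K)
    (T S : ℝ → (HS n →L[ℂ] HS n))
    (hT : ∀ ℏ ∈ Ioc (0:ℝ) 1, rhoSpec n ℏ f (T ℏ))
    (hS : ∀ ℏ ∈ Ioc (0:ℝ) 1, kappaSpec n ℏ K (S ℏ))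
    (a : ℝ) (ha : ∃ᶠ ℏ in 𝓝[>] (0:ℝ), ‖T ℏ + S ℏ‖ < a) (x0 : Eb n) (η : Ef n → ℂ)
    (hη : MemLp η 2 (muPlus n)) :
    eLpNorm (Gk (fun v w => kf f 0 x0 v w + kK K 0 x0 v w) η) 2 (muPlus n) ≤
      ENNReal.ofReal a * eLpNorm η 2 (muPlus n) := by
  obtain ⟨C, R, hC, hkf⟩ := kf_bound f hf hf'
  obtain ⟨C', R', hC', hkK⟩ := kK_bound K hK hK'
  have hev : ∀ᶠ ℏ in 𝓝[>] (0:ℝ), ℏ ∈ Ioc (0:ℝ) 1 := Ioc_mem_nhdsGT one_pos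
  obtain ⟨s, hs, hsa⟩ := exists_seq_forall_of_frequently (ha.and_eventually hev)
  have hs0 : Tendsto s atTop (𝓝 0) := hs.mono_right nhdsWithin_le_nhds
  have hfb := fun i => fiber_bound_h f hf hf' K hK hK' (hsa i).2.1 _ _ (hT _ (hsa i).2)
    (hS _ (hsa i).2) x0 η hη
  refine (Lp.eLpNorm_lim_le_liminf_eLpNorm (p := 2) (fun i => (hfb i).1) _
    (Eventually.of_forall fun v => ?_)).trans ?_
  · have hKB := fun ℏ => KB_add hC hC' (hkf ℏ x0) (hkK ℏ x0)
    refine tendsto_integral_of_dominated_convergence _ (fun i => ?_)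
      (bound_integrable (C + C') (max R R') η hη v)
      (fun i => Eventually.of_forall fun w => KB_norm (hKB (s i)) η v w)
      (Eventually.of_forall fun w => ?_)
    · exact (((kf_cont f hf _ x0 v).add (kK_cont K hK _ x0 v)).aestronglyMeasurable).mul hη.1
    · have hc : Continuous (fun ℏ : ℝ => (kf f ℏ x0 v w + kK K ℏ x0 v w) * η w) := by
        unfold kf kK; fun_prop
      exact (hc.tendsto 0).comp hs0
  · refine liminf_le_of_frequently_le' (Frequently.of_forall fun i => ?_)
    refine (hfb i).2.trans ?_
    gcongr
    exact (hsa i).1.le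

/-- For every `f ∈ C_c^∞(ℝⁿ×ℝⁿ)` and every smooth compactly supported `K` on
`ℝ^{n−1}×ℝ^{n−1}×ℝ₊×ℝ₊`, `liminf_{ℏ→0⁺} ‖ρ_ℏ(f)+κ_ℏ(K)‖ ≥ ‖π₀^∂(f⊕K)‖`. -/
theorem statement13 (n : ℕ) (hn : 1 ≤ n) (f : Ef n × Ef n → ℂ)
    (hf : ContDiff ℝ ∞ f) (hf' : HasCompactSupport f)
    (K : Eb n × Eb n × ℝ × ℝ → ℂ)
    (hK : ContDiff ℝ ∞ K) (hK' : HasCompactSupport K)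
    (T S : ℝ → (HS n →L[ℂ] HS n))
    (hT : ∀ ℏ ∈ Ioc (0:ℝ) 1, rhoSpec n ℏ f (T ℏ))
    (hS : ∀ ℏ ∈ Ioc (0:ℝ) 1, kappaSpec n ℏ K (S ℏ))
    (B : HB n →L[ℂ] HB n) (hB : piBSpec n f K B) :
    ‖B‖ ≤ Filter.liminf (fun ℏ => ‖T ℏ + S ℏ‖) (𝓝[>] (0:ℝ)) := by
  have hfc := hf.continuous
  have hKc := hK.continuous
  obtain ⟨C, R, hC, hkf⟩ := kf_bound f hfc hf'
  obtain ⟨C', R', hC', hkK⟩ := kK_bound K hKc hK'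
  obtain ⟨M, hM⟩ := unif_bound f hfc hf' K hKc hK'
  have hev : ∀ᶠ ℏ in 𝓝[>] (0:ℝ), ℏ ∈ Ioc (0:ℝ) 1 := Ioc_mem_nhdsGT one_pos
  have hbdd : IsBoundedUnder (· ≤ ·) (𝓝[>] (0:ℝ)) (fun ℏ => ‖T ℏ + S ℏ‖) :=
    isBoundedUnder_of_eventually_le (a := M) (by
      filter_upwards [hev] with ℏ h using hM ℏ h.1 _ _ (hT _ h) (hS _ h))
  refine le_of_forall_gt_imp_ge_of_dense fun a ha => ?_
  have hfr := frequently_lt_of_liminf_lt hbdd.isCoboundedUnder_ge ha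
  have ha0 : 0 ≤ a := by
    obtain ⟨x, hx⟩ := hfr.exists
    exact (norm_nonneg _).trans hx.le
  refine ContinuousLinearMap.opNorm_le_bound _ ha0 fun ξ => ?_
  have key : eLpNorm (⇑(B ξ)) 2 (muB n) ≤ ENNReal.ofReal a * eLpNorm (⇑ξ) 2 (muB n) := by
    refine (ENNReal.pow_le_pow_left_iff (n := 2) (by norm_num)).1 ?_
    have hξm : MemLp (⇑ξ) 2 (muB n) := Lp.memLp ξ
    have hBm : MemLp (⇑(B ξ)) 2 (muB n) := Lp.memLp (B ξ)
    have hspec := hB ξ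
    have hfin : ∫⁻ q, ‖ξ q‖ₑ ^ 2 ∂(muB n) ≠ ⊤ := by
      rw [← eLpNorm_sq]; exact ENNReal.pow_ne_top hξm.2.ne
    rw [mul_pow, eLpNorm_sq, eLpNorm_sq]
    generalize hb : (⇑(B ξ) : Eb n × Eb n × ℝ → ℂ) = b at *
    generalize hx : (⇑ξ : Eb n × Eb n × ℝ → ℂ) = x at *
    rw [muB_eq_prod] at *
    have hxe : AEMeasurable (fun q => ‖x q‖ₑ ^ 2) ((volume : Measure (Eb n)).prod (muPlus n)) :=
      hξm.1.enorm.pow_const 2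
    rw [lintegral_prod _ hxe, lintegral_prod _ (hBm.1.enorm.pow_const 2),
      ← lintegral_const_mul' _ _ (by simp)]
    rw [lintegral_prod _ hxe] at hfin
    refine lintegral_mono_ae ?_
    have hfin' := ae_lt_top' hxe.lintegral_prod_right' hfin
    filter_upwards [hfin', hξm.1.prodMk_left, Measure.ae_ae_of_ae_prod hspec] with x0 h1 h2 h3
    have hη : MemLp (fun y => x (x0, y)) 2 (muPlus n) := by
      refine ⟨h2, ?_⟩
      rw [← eLpNorm_sq] at h1
      by_contra hh
      rw [not_lt, top_le_iff] at hh
      rw [hh] at h1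
      simp at h1
    have hfb := fiber_bound f hfc hf' K hKc hK' T S hT hS a hfr x0 _ hη
    have hG : (fun y => b (x0, y)) =ᵐ[muPlus n]
        Gk (fun v w => kf f 0 x0 v w + kK K 0 x0 v w) (fun y => x (x0, y)) := by
      filter_upwards [h3] with v hv
      rw [hv]
      have i := KB_integrable (KB_add hC hC' (hkf 0 x0) (hkK 0 x0))
        (fun v => (kf_cont f hfc 0 x0 v).add (kK_cont K hKc 0 x0 v)) _ hη v
      unfold Gk
      rw [integral_muPlus _ i]
      simp [kf, kK]
    rw [← eLpNorm_sq, ← eLpNorm_sq, ← mul_pow, eLpNorm_congr_ae hG]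
    gcongr
  rw [Lp.norm_def, Lp.norm_def, ← ENNReal.toReal_ofReal ha0, ← ENNReal.toReal_mul]
  exact ENNReal.toReal_mono (ENNReal.mul_ne_top (by simp) (Lp.eLpNorm_ne_top ξ)) key
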